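/- Let S ⊂ ℙ²(ℝ) with |S| = 9 be such that there exists a psd sextic form vanishing at every point of S that is not a sum of squares. Let P ∈ S and T = S \ {P}. Let f, f' be cubic forms spanning the space I₃(T) of cubics vanishing on T, and let g be a sextic form such that f², ff', f'², g span the space I₆(2T) of sextics singular at every point of T. Then the Jacobian determinant j = det J(f,f',g) vanishes at P. -/

import Mathlib

open MvPolynomial

noncomputable section

/-- The real projective plane, as lines through the origin of `ℝ³`. -/
abbrev P2 := Projectivization ℝ (Fin 3 → ℝ)

/-- A polynomial is psd if it takes only nonnegative values on `ℝ³`. -/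
def Psd (g : MvPolynomial (Fin 3) ℝ) : Prop := ∀ u : Fin 3 → ℝ, 0 ≤ eval u g

/-- A polynomial is sos if it is a finite sum of squares. -/
def Sos (g : MvPolynomial (Fin 3) ℝ) : Prop :=
  ∃ (n : ℕ) (h : Fin n → MvPolynomial (Fin 3) ℝ), g = ∑ i, (h i) ^ 2

/-- A form vanishes at a point of `ℙ²(ℝ)` if it vanishes at a representative vector. -/
def VanishAt (g : MvPolynomial (Fin 3) ℝ) (P : P2) : Prop := eval P.rep g = 0

/-- A form is singular at a point of `ℙ²(ℝ)` if it and all its first partial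
derivatives vanish at a representative vector. -/
def SingAt (g : MvPolynomial (Fin 3) ℝ) (P : P2) : Prop :=
  eval P.rep g = 0 ∧ ∀ i, eval P.rep (pderiv i g) = 0

/-- `I_d(T)`: the space of degree-`d` forms vanishing at every point of `T`. -/
def Isub (d : ℕ) (T : Set P2) : Submodule ℝ (MvPolynomial (Fin 3) ℝ) :=
  (homogeneousSubmodule (Fin 3) ℝ d) ⊓
  { carrier := {f | ∀ P ∈ T, VanishAt f P}
    zero_mem' := by intro P _; simp [VanishAt]
    add_mem' := by
      intro a b ha hb P hP
      have h1 := ha P hP; have h2 := hb P hP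
      unfold VanishAt at *; simp [h1, h2]
    smul_mem' := by
      intro c f hf P hP
      have h1 := hf P hP
      unfold VanishAt at *; simp [smul_eq_C_mul, h1] }

/-- `I_d(2T)`: the space of degree-`d` forms singular at every point of `T`. -/
def Isub2 (d : ℕ) (T : Set P2) : Submodule ℝ (MvPolynomial (Fin 3) ℝ) :=
  (homogeneousSubmodule (Fin 3) ℝ d) ⊓
  { carrier := {f | ∀ P ∈ T, SingAt f P}
    zero_mem' := by intro P _; constructor <;> simp [SingAt]
    add_mem' := by
      intro a b ha hb P hP
      obtain ⟨h1, h2⟩ := ha P hP; obtain ⟨h3, h4⟩ := hb P hP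
      exact ⟨by simp [h1, h3], fun i => by simp [h2 i, h4 i]⟩
    smul_mem' := by
      intro c f hf P hP
      obtain ⟨h1, h2⟩ := hf P hP
      refine ⟨by simp [smul_eq_C_mul, h1], fun i => ?_⟩
      have := h2 i
      simp [smul_eq_C_mul, this] }

/-- `I₃(T)²`: the span of products of two cubics vanishing on `T`. -/
def IsqCubic (T : Set P2) : Submodule ℝ (MvPolynomial (Fin 3) ℝ) :=
  Submodule.span ℝ {h | ∃ f₁ ∈ Isub 3 T, ∃ f₂ ∈ Isub 3 T, h = f₁ * f₂}

/-- No 4 points of `T` on a line, no 7 on a conic. -/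
def GenPos (T : Set P2) : Prop :=
  (∀ l : MvPolynomial (Fin 3) ℝ, l ≠ 0 → l.IsHomogeneous 1 →
    {P ∈ T | VanishAt l P}.encard ≤ 3) ∧
  (∀ c : MvPolynomial (Fin 3) ℝ, c ≠ 0 → c.IsHomogeneous 2 →
    {P ∈ T | VanishAt c P}.encard ≤ 6)

/-- The real projective zero set of `g`. -/
def VR (g : MvPolynomial (Fin 3) ℝ) : Set P2 := {P | VanishAt g P}


/-- The Jacobian determinant of three forms. -/
def jacR (f f' g : MvPolynomial (Fin 3) ℝ) : MvPolynomial (Fin 3) ℝ :=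
  Matrix.det (Matrix.of fun i j => pderiv j (![f, f', g] i))


theorem aux_elim {R : Type*} [CommRing R] [IsDomain R] [UniqueFactorizationMonoid R]
    (L M : Polynomial R) (h : IsRelPrime L M) :
    ∃ (a b : Polynomial R) (c : R), c ≠ 0 ∧ L * a + M * b = Polynomial.C c := by
  let K := FractionRing R
  let : NormalizedGCDMonoid R := Nonempty.some inferInstance
  have hinj : Function.Injective (algebraMap R K) := IsFractionRing.injective R K
  have hcop : IsCoprime (L.map (algebraMap R K)) (M.map (algebraMap R K)) := by
    rw [← isRelPrime_iff_isCoprime]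
    intro d hd1 hd2
    have hd0 : d ≠ 0 := by
      rintro rfl
      rw [zero_dvd_iff, Polynomial.map_eq_zero_iff hinj] at hd1 hd2
      subst hd1 hd2
      have := h (d := 0) (dvd_refl _) (dvd_refl _)
      simp at this
    apply Polynomial.isUnit_or_eq_zero_of_isUnit_integerNormalization_primPart (R := R) hd0
    have hdd : ((IsLocalization.integerNormalization (nonZeroDivisors R) d).primPart).map
        (algebraMap R K) ∣ d := by
      obtain ⟨c, c0, hc⟩ := IsLocalization.integerNormalization_spec (nonZeroDivisors R) d
      have h1 : ((IsLocalization.integerNormalization (nonZeroDivisors R) d).primPart).map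
        (algebraMap R K) ∣ (IsLocalization.integerNormalization (nonZeroDivisors R) d).map
        (algebraMap R K) := by
        apply Polynomial.map_dvd
        exact Polynomial.primPart_dvd _
      rw [hc] at h1
      rw [Algebra.smul_def, Polynomial.algebraMap_apply] at h1
      refine (IsUnit.dvd_mul_left ?_).1 h1
      rw [Polynomial.isUnit_C, isUnit_iff_ne_zero]
      have : c ≠ 0 := nonZeroDivisors.ne_zero c0
      exact fun e => this ((injective_iff_map_eq_zero _).1 hinj _ e)
    apply h
    · exact (Polynomial.isPrimitive_primPart _).dvd_of_fraction_map_dvd_fraction_map (hdd.trans hd1)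
    · exact (Polynomial.isPrimitive_primPart _).dvd_of_fraction_map_dvd_fraction_map (hdd.trans hd2)
  have hres : L.resultant M ≠ 0 := by
    intro h0
    have h1 : (L.map (algebraMap R K)).resultant (M.map (algebraMap R K)) = 0 := by
      rw [Polynomial.natDegree_map_eq_of_injective hinj,
        Polynomial.natDegree_map_eq_of_injective hinj, Polynomial.resultant_map_map, h0, map_zero]
    exact (Polynomial.resultant_eq_zero_iff.1 h1).2 hcop
  by_cases hd : L.natDegree ≠ 0 ∨ M.natDegree ≠ 0
  · obtain ⟨p, q, -, -, e⟩ := Polynomial.exists_mul_add_mul_eq_C_resultant L M le_rfl le_rfl hd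
    exact ⟨p, q, _, hres, e⟩
  · push Not at hd
    obtain ⟨l, hl⟩ := Polynomial.natDegree_eq_zero.1 hd.1
    obtain ⟨m, hm⟩ := Polynomial.natDegree_eq_zero.1 hd.2
    by_cases hl0 : l = 0
    · refine ⟨0, 1, m, ?_, by simp [hm]⟩
      rintro rfl
      subst hl0
      simp at hl hm
      subst hl hm
      have := h (d := 0) (dvd_refl _) (dvd_refl _)
      simp at this
    · exact ⟨1, 0, l, hl0, by simp [hl]⟩

theorem aux_relprime_equiv {A B : Type*} [CommRing A] [CommRing B] (e : A ≃+* B) {a b : A}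
    (h : IsRelPrime a b) : IsRelPrime (e a) (e b) := by
  intro d h1 h2
  have : IsUnit (e.symm d) := by
    apply h
    · simpa using map_dvd e.symm h1
    · simpa using map_dvd e.symm h2
  simpa using this.map e

/-- no sign change along the first coordinate -/
theorem aux_axis (L M : MvPolynomial (Fin 3) ℝ) (h : IsRelPrime L M)
    (hp : ∀ u, 0 ≤ eval u L * eval u M) (x x' : ℝ) (y : Fin 2 → ℝ)
    (h1 : 0 < eval (Fin.cons x y : Fin 3 → ℝ) (L + M))
    (h2 : eval (Fin.cons x' y : Fin 3 → ℝ) (L + M) < 0) : False := by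
  obtain ⟨a, b, c, hc, e⟩ := aux_elim _ _
    (aux_relprime_equiv (finSuccEquiv ℝ 2).toRingEquiv h)
  apply hc
  have hcont : ∀ x : ℝ, Continuous fun y : Fin 2 → ℝ => eval (Fin.cons x y : Fin 3 → ℝ) (L + M) := by
    intro x
    have := MvPolynomial.continuous_eval (L + M)
    exact this.comp (by fun_prop)
  have hcont' : ∀ y : Fin 2 → ℝ, Continuous fun x : ℝ => eval (Fin.cons x y : Fin 3 → ℝ) (L + M) := by
    intro x
    have := MvPolynomial.continuous_eval (L + M)
    exact this.comp (by fun_prop)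
  have ev1 := (hcont x).continuousAt.eventually (lt_mem_nhds h1)
  have ev2 := (hcont x').continuousAt.eventually (gt_mem_nhds h2)
  obtain ⟨ε, hε, hball⟩ := Metric.eventually_nhds_iff_ball.1 (ev1.and ev2)
  apply funext_set (fun i => Metric.ball (y i) ε)
  · intro i
    rw [Real.ball_eq_Ioo]
    exact Set.Ioo_infinite (by linarith)
  · intro z hz
    have hz' : z ∈ Metric.ball y ε := by
      rw [ball_pi _ hε]; exact hz
    obtain ⟨g1, g2⟩ := hball z hz'
    obtain ⟨t, ht⟩ := mem_range_of_exists_le_of_exists_ge (hcont' z) ⟨x', g2.le⟩ ⟨x, g1.le⟩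
    simp only [map_add] at ht
    have hh := hp (Fin.cons t z : Fin 3 → ℝ)
    have hL : eval (Fin.cons t z : Fin 3 → ℝ) L = 0 := by nlinarith
    have hM : eval (Fin.cons t z : Fin 3 → ℝ) M = 0 := by linarith
    rw [eval_eq_eval_mv_eval'] at hL hM
    have := congrArg (fun q => Polynomial.eval t (Polynomial.map (eval z) q)) e
    simp at this hL hM
    rw [hL, hM] at this
    simp at this
    simp [← this]

def shear (d : Fin 3 → ℝ) : MvPolynomial (Fin 3) ℝ →ₐ[ℝ] MvPolynomial (Fin 3) ℝ :=
  aeval ![C (d 0) * X 0, X 1 + C (d 1) * X 0, X 2 + C (d 2) * X 0]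

def shearInv (d : Fin 3 → ℝ) : MvPolynomial (Fin 3) ℝ →ₐ[ℝ] MvPolynomial (Fin 3) ℝ :=
  aeval ![C (d 0)⁻¹ * X 0, X 1 - C (d 1 * (d 0)⁻¹) * X 0, X 2 - C (d 2 * (d 0)⁻¹) * X 0]

def shearEquiv (d : Fin 3 → ℝ) (hd : d 0 ≠ 0) :
    MvPolynomial (Fin 3) ℝ ≃ₐ[ℝ] MvPolynomial (Fin 3) ℝ :=
  AlgEquiv.ofAlgHom (shear d) (shearInv d)
    (by
      have h : (C (d 0)⁻¹ * C (d 0) : MvPolynomial (Fin 3) ℝ) = 1 := by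
        rw [← C_mul, inv_mul_cancel₀ hd, C_1]
      ext i : 1
      fin_cases i <;> simp [shear, shearInv, algHom_C, algebraMap_eq, -map_inv₀]
      · linear_combination X 0 * h
      · linear_combination - C (d 1) * X 0 * h
      · linear_combination - C (d 2) * X 0 * h)
    (by
      have h : (C (d 0)⁻¹ * C (d 0) : MvPolynomial (Fin 3) ℝ) = 1 := by
        rw [← C_mul, inv_mul_cancel₀ hd, C_1]
      ext i : 1
      fin_cases i <;> simp [shear, shearInv, algHom_C, algebraMap_eq, -map_inv₀]
      · linear_combination X 0 * h
      · ring
      · ring)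

theorem eval_shear (d u : Fin 3 → ℝ) (p : MvPolynomial (Fin 3) ℝ) :
    eval u (shear d p) = eval ![d 0 * u 0, u 1 + d 1 * u 0, u 2 + d 2 * u 0] p := by
  have : (eval u).comp (shear d : MvPolynomial (Fin 3) ℝ →+* MvPolynomial (Fin 3) ℝ)
      = eval ![d 0 * u 0, u 1 + d 1 * u 0, u 2 + d 2 * u 0] := by
    ext i
    · simp [shear, algHom_C, algebraMap_eq]
    · fin_cases i <;> simp [shear, algHom_C, algebraMap_eq]
  exact congrArg (fun q => q p) this

theorem aux_nosign (L M : MvPolynomial (Fin 3) ℝ) (h : IsRelPrime L M)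
    (hp : ∀ u, 0 ≤ eval u L * eval u M) (u v : Fin 3 → ℝ)
    (h1 : 0 < eval u (L + M)) (h2 : eval v (L + M) < 0) : False := by
  obtain ⟨v, h2, hd⟩ : ∃ v, eval v (L + M) < 0 ∧ (v - u) 0 ≠ 0 := by
    by_cases h0 : (v - u) 0 = 0
    · have hc : Continuous fun t : ℝ => eval (v + t • ![1, 0, 0]) (L + M) :=
        (MvPolynomial.continuous_eval (L + M)).comp (by fun_prop)
      have h20 : eval (v + (0 : ℝ) • ![1, 0, 0]) (L + M) < 0 := by
        rw [zero_smul, add_zero]; exact h2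
      have ev := (hc.continuousAt (x := 0)).eventually (gt_mem_nhds h20)
      obtain ⟨ε, hε, hb⟩ := Metric.eventually_nhds_iff_ball.1 ev
      refine ⟨v + (ε / 2) • ![1, 0, 0], hb _ ?_, ?_⟩
      · simp [abs_of_pos hε]; exact hε
      · simp only [Pi.sub_apply, Pi.add_apply, Pi.smul_apply, Matrix.cons_val_zero, smul_eq_mul,
          mul_one] at h0 ⊢
        intro h
        linarith
    · exact ⟨v, h2, h0⟩
  set d := v - u with hdd
  let w : Fin 2 → ℝ := ![u 1 - d 1 * (u 0 / d 0), u 2 - d 2 * (u 0 / d 0)]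
  refine aux_axis (shear d L) (shear d M)
    (aux_relprime_equiv (shearEquiv d hd).toRingEquiv h) ?_ (u 0 / d 0) (u 0 / d 0 + 1) w ?_ ?_
  · intro z
    rw [eval_shear, eval_shear]; exact hp _
  · rw [← map_add, eval_shear]
    have hvec : ![d 0 * (Fin.cons (u 0 / d 0) w : Fin 3 → ℝ) 0,
        (Fin.cons (u 0 / d 0) w : Fin 3 → ℝ) 1 + d 1 * (Fin.cons (u 0 / d 0) w : Fin 3 → ℝ) 0,
        (Fin.cons (u 0 / d 0) w : Fin 3 → ℝ) 2 + d 2 * (Fin.cons (u 0 / d 0) w : Fin 3 → ℝ) 0]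
        = u := by
      have c1 : (Fin.cons (u 0 / d 0) w : Fin 3 → ℝ) 1 = w 0 := rfl
      have c2 : (Fin.cons (u 0 / d 0) w : Fin 3 → ℝ) 2 = w 1 := rfl
      ext i
      fin_cases i <;> simp [w, c1, c2]
      field_simp
    rw [hvec]; exact h1
  · rw [← map_add, eval_shear]
    have hvec : ![d 0 * (Fin.cons (u 0 / d 0 + 1) w : Fin 3 → ℝ) 0,
        (Fin.cons (u 0 / d 0 + 1) w : Fin 3 → ℝ) 1 +
          d 1 * (Fin.cons (u 0 / d 0 + 1) w : Fin 3 → ℝ) 0,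
        (Fin.cons (u 0 / d 0 + 1) w : Fin 3 → ℝ) 2 +
          d 2 * (Fin.cons (u 0 / d 0 + 1) w : Fin 3 → ℝ) 0] = v := by
      have c1 : (Fin.cons (u 0 / d 0 + 1) w : Fin 3 → ℝ) 1 = w 0 := rfl
      have c2 : (Fin.cons (u 0 / d 0 + 1) w : Fin 3 → ℝ) 2 = w 1 := rfl
      have : v = u + d := by simp [hdd]
      rw [this]
      ext i
      fin_cases i <;> simp [w, c1, c2]
      · field_simp
      · ring
      · ring
    rw [hvec]; exact h2

/-- The substitution `X i ↦ X i * T`. -/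
def grd : MvPolynomial (Fin 3) ℝ →ₐ[ℝ] Polynomial (MvPolynomial (Fin 3) ℝ) :=
  aeval fun i => Polynomial.C (X i) * Polynomial.X

theorem grd_monomial (s : Fin 3 →₀ ℕ) (a : ℝ) :
    grd (monomial s a) = Polynomial.C (monomial s a) * Polynomial.X ^ s.degree := by
  rw [grd, aeval_monomial, monomial_eq, Finsupp.prod_fintype _ _ (by simp),
    Finsupp.prod_fintype _ _ (by simp)]
  simp only [mul_pow, Finset.prod_mul_distrib, Finset.prod_pow_eq_pow_sum, Finsupp.degree_eq_sum,
    map_mul, map_prod, map_pow]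
  rw [mul_assoc]
  rfl

theorem grd_hom {p : MvPolynomial (Fin 3) ℝ} {d : ℕ} (hp : p.IsHomogeneous d) :
    grd p = Polynomial.C p * Polynomial.X ^ d := by
  conv_lhs => rw [p.as_sum]
  conv_rhs => rw [p.as_sum]
  rw [map_sum, map_sum, Finset.sum_mul]
  apply Finset.sum_congr rfl
  intro s hs
  rw [grd_monomial]
  congr 2
  have := hp (mem_support_iff.1 hs)
  rw [← this, Finsupp.degree_eq_weight_one]
  rfl

theorem grd_coeff (p : MvPolynomial (Fin 3) ℝ) (n : ℕ) :
    (grd p).coeff n = homogeneousComponent n p := by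
  have h : grd p = ∑ i ∈ Finset.range (p.totalDegree + 1),
      Polynomial.C (homogeneousComponent i p) * Polynomial.X ^ i := by
    conv_lhs => rw [← sum_homogeneousComponent p]
    rw [map_sum]
    exact Finset.sum_congr rfl fun i _ => grd_hom (homogeneousComponent_isHomogeneous i p)
  rw [h, Polynomial.finsetSum_coeff]
  simp only [Polynomial.coeff_C_mul_X_pow]
  rw [Finset.sum_ite_eq]
  split_ifs with h1
  · rfl
  · rw [homogeneousComponent_eq_zero]
    simp at h1
    omega

theorem hom_factor {a b : MvPolynomial (Fin 3) ℝ} {d : ℕ} (h : (a * b).IsHomogeneous d)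
    (h0 : a * b ≠ 0) : ∃ k l, k + l = d ∧ a.IsHomogeneous k ∧ b.IsHomogeneous l := by
  have e : grd a * grd b = Polynomial.C (a * b) * Polynomial.X ^ d := by
    rw [← map_mul, grd_hom h]
  have hne : grd a * grd b ≠ 0 := by
    rw [e]
    exact mul_ne_zero (by simpa using h0) (pow_ne_zero _ Polynomial.X_ne_zero)
  have ha : grd a ≠ 0 := left_ne_zero_of_mul hne
  have hb : grd b ≠ 0 := right_ne_zero_of_mul hne
  have e1 : (grd a).natDegree + (grd b).natDegree = d := by
    rw [← Polynomial.natDegree_mul ha hb, e, Polynomial.natDegree_C_mul_X_pow _ _ h0]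
  have e2 : (grd a).natTrailingDegree + (grd b).natTrailingDegree = d := by
    rw [← Polynomial.natTrailingDegree_mul ha hb, e, Polynomial.C_mul_X_pow_eq_monomial,
      Polynomial.natTrailingDegree_monomial h0]
  have t1 := Polynomial.natTrailingDegree_le_natDegree (grd a)
  have t2 := Polynomial.natTrailingDegree_le_natDegree (grd b)
  have key : ∀ q : MvPolynomial (Fin 3) ℝ, (grd q).natTrailingDegree = (grd q).natDegree →
      q.IsHomogeneous (grd q).natDegree := by
    intro q hq
    have : q = homogeneousComponent (grd q).natDegree q := by
      conv_lhs => rw [← sum_homogeneousComponent q]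
      have hz : ∀ i, i ≠ (grd q).natDegree → homogeneousComponent i q = 0 := by
        intro i hi
        rw [← grd_coeff]
        rcases lt_or_gt_of_ne hi with hi | hi
        · exact Polynomial.coeff_eq_zero_of_lt_natTrailingDegree (by omega)
        · exact Polynomial.coeff_eq_zero_of_natDegree_lt hi
      rw [Finset.sum_eq_single (grd q).natDegree]
      · intro i _ hi; exact hz i hi
      · intro hi
        apply homogeneousComponent_eq_zero
        simp at hi
        omega
    rw [this, ← this]
    conv_lhs => rw [this]
    exact homogeneousComponent_isHomogeneous _ _
  exact ⟨_, _, e1, key a (by omega), key b (by omega)⟩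

theorem sos_of_isSumSq {p : MvPolynomial (Fin 3) ℝ} (h : IsSumSq p) : Sos p := by
  induction h with
  | zero => exact ⟨0, Fin.elim0, by simp⟩
  | sq_add a hs ih =>
    obtain ⟨n, h, rfl⟩ := ih
    refine ⟨n + 1, Fin.cons a h, ?_⟩
    rw [Fin.sum_univ_succ]
    simp [sq]

theorem isSumSq_C {r : ℝ} (hr : 0 ≤ r) : IsSumSq (C r : MvPolynomial (Fin 3) ℝ) := by
  have : (C r : MvPolynomial (Fin 3) ℝ) = C (√r) * C (√r) := by
    rw [← C_mul, Real.mul_self_sqrt hr]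
  rw [this]; exact IsSumSq.mul_self _

theorem isSumSq_quad {q : MvPolynomial (Fin 3) ℝ} (hq : q.IsHomogeneous 2) (hp : Psd q) :
    IsSumSq q := by
  let H : Matrix (Fin 3) (Fin 3) ℝ := fun i j => constantCoeff (pderiv j (pderiv i q))
  have hH : ∀ i j, pderiv j (pderiv i q) = C (H i j) := by
    intro i j
    have h2 : (pderiv j (pderiv i q)).IsHomogeneous 0 := hq.pderiv.pderiv
    have := (totalDegree_zero_iff_isHomogeneous (p := pderiv j (pderiv i q))).2 h2
    rw [totalDegree_eq_zero_iff_eq_C] at this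
    exact this
  have e1 : ∀ i, ∑ j, X j * C (H i j) = pderiv i q := by
    intro i
    have h1 : (pderiv i q).IsHomogeneous 1 := hq.pderiv
    have := h1.sum_X_mul_pderiv
    simp only [hH, one_smul] at this
    exact this
  have e2 : ∑ i, X i * ∑ j, X j * C (H i j) = 2 * q := by
    have := hq.sum_X_mul_pderiv
    simp only [e1, this, nsmul_eq_mul]
    norm_num
  have hev : ∀ x : Fin 3 → ℝ, ∑ i, x i * ∑ j, x j * H i j = 2 * eval x q := by
    intro x
    have := congrArg (eval x) e2
    simpa using this
  have hps : H.PosSemidef := by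
    rw [Matrix.posSemidef_iff_dotProduct_mulVec]
    constructor
    · ext i j
      have : pderiv j (pderiv i q) = pderiv i (pderiv j q) := by
        have h0 : ⁅pderiv (R := ℝ) j, pderiv (R := ℝ) i⁆ = 0 := by
          apply MvPolynomial.derivation_ext
          intro k
          simp [Derivation.commutator_apply, pderiv_X, Pi.single_apply, apply_ite]
        have h1 := congrArg (fun D => D q) h0
        simpa [Derivation.commutator_apply, sub_eq_zero] using h1
      rw [Matrix.conjTranspose_apply, star_trivial]
      exact (congrArg constantCoeff this).symm
    · intro x
      have : star x ⬝ᵥ (H.mulVec x) = 2 * eval x q := by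
        rw [← hev]
        simp [dotProduct, Matrix.mulVec, mul_comm]
      rw [this]
      have := hp x
      positivity
  obtain ⟨m, v, hv⟩ := Matrix.posSemidef_iff_eq_sum_vecMulVec.1 hps
  have e3 : q = C (1 / 2 : ℝ) * ∑ k, (∑ i, X i * C (v k i)) ^ 2 := by
    apply MvPolynomial.funext
    intro x
    have h1 := hev x
    rw [hv] at h1
    have : ∑ k, (∑ i, x i * v k i) ^ 2 = 2 * eval x q := by
      rw [← h1]
      simp only [Matrix.sum_apply, Matrix.vecMulVec_apply, Fin.sum_univ_three (M := ℝ),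
        Pi.star_apply, star_trivial, Finset.mul_sum, ← Finset.sum_add_distrib]
      apply Finset.sum_congr rfl
      intro k _
      ring
    simp only [map_mul, map_sum, map_pow, eval_C, eval_X, this]
    ring
  rw [e3]
  exact (isSumSq_C (by norm_num)).mul (IsSumSq.sum_sq _ _)

theorem psd_form_isSumSq {q : MvPolynomial (Fin 3) ℝ} {d : ℕ} (hd : d ≤ 3)
    (hq : q.IsHomogeneous d) (hp : Psd q) : IsSumSq q := by
  have hodd : Odd d → q = 0 := by
    intro ho
    apply MvPolynomial.funext
    intro u
    have h1 := hp u
    have h2 := hp ((-1 : ℝ) • u)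
    have h3 : eval ((-1 : ℝ) • u) q = (-1) ^ d * eval u q := by
      rw [eval_eq', eval_eq', Finset.mul_sum]
      apply Finset.sum_congr rfl
      intro s hs
      have hs := hq (mem_support_iff.1 hs)
      have : s.degree = d := by
        rw [← hs, Finsupp.degree_eq_weight_one]; rfl
      rw [← this, Finsupp.degree_eq_sum]
      simp only [Pi.smul_apply, smul_eq_mul, mul_pow]
      rw [← Finset.prod_pow_eq_pow_sum, Finset.prod_mul_distrib]
      ring
    rw [h3, ho.neg_one_pow] at h2
    simp
    linarith
  interval_cases d
  · have := (totalDegree_zero_iff_isHomogeneous (p := q)).2 hq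
    rw [totalDegree_eq_zero_iff_eq_C] at this
    have h0 := hp 0
    rw [this] at h0 ⊢
    exact isSumSq_C (by simpa using h0)
  · rw [hodd (by decide)]; exact IsSumSq.zero
  · exact isSumSq_quad hq hp
  · rw [hodd (by decide)]; exact IsSumSq.zero

theorem isSumSq_mul_cubics {L M : MvPolynomial (Fin 3) ℝ} (hL : L.IsHomogeneous 3)
    (hM : M.IsHomogeneous 3) (hp : Psd (L * M)) : IsSumSq (L * M) := by
  by_cases hL0 : L = 0
  · simp [hL0]
  by_cases hM0 : M = 0
  · simp [hM0]
  obtain ⟨a, b, c, hab, rfl, rfl⟩ := UniqueFactorizationMonoid.exists_reduced_factors L hL0 M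
  obtain ⟨k, l, hkl, -, ha⟩ := hom_factor hL hL0
  obtain ⟨k', l', hkl', -, hb⟩ := hom_factor hM hM0
  have hc0 : c ≠ 0 := left_ne_zero_of_mul hL0
  have hpos : ∀ u, 0 ≤ eval u a * eval u b := by
    by_contra hcon
    push Not at hcon
    obtain ⟨u, hu⟩ := hcon
    have hcont : Continuous fun u => eval u a * eval u b :=
      (MvPolynomial.continuous_eval a).mul (MvPolynomial.continuous_eval b)
    obtain ⟨ε, hε, hball⟩ := Metric.eventually_nhds_iff_ball.1
      (hcont.continuousAt.eventually (gt_mem_nhds hu))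
    apply hc0
    apply funext_set (fun i => Metric.ball (u i) ε)
    · intro i
      rw [Real.ball_eq_Ioo]
      exact Set.Ioo_infinite (by linarith)
    · intro z hz
      have hz' : z ∈ Metric.ball u ε := by
        rw [ball_pi _ hε]; exact hz
      have h1 := hball z hz'
      have h2 := hp z
      simp only [map_mul] at h2
      rw [map_zero]
      by_contra hne
      have : 0 < eval z c ^ 2 := by positivity
      nlinarith
  have hab' : IsSumSq (a * b) := by
    by_cases hN : ∀ u, 0 ≤ eval u (a + b)
    · refine (psd_form_isSumSq (by omega) ha ?_).mul (psd_form_isSumSq (by omega) hb ?_)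
      · intro u
        have h1 := hN u
        have h2 := hpos u
        rw [map_add] at h1
        by_contra hlt
        push Not at hlt
        nlinarith
      · intro u
        have h1 := hN u
        have h2 := hpos u
        rw [map_add] at h1
        by_contra hlt
        push Not at hlt
        nlinarith
    · push Not at hN
      obtain ⟨v, hv⟩ := hN
      have hN : ∀ u, eval u (a + b) ≤ 0 := by
        intro u
        by_contra hu
        push Not at hu
        exact aux_nosign a b hab hpos u v hu hv
      rw [← neg_mul_neg]
      refine (psd_form_isSumSq (by omega) ha.neg ?_).mul (psd_form_isSumSq (by omega) hb.neg ?_)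
      · intro u
        have h1 := hN u
        have h2 := hpos u
        rw [map_add] at h1
        rw [map_neg]
        by_contra hlt
        push Not at hlt
        nlinarith
      · intro u
        have h1 := hN u
        have h2 := hpos u
        rw [map_add] at h1
        rw [map_neg]
        by_contra hlt
        push Not at hlt
        nlinarith
  have : c * a * (c * b) = (c * c) * (a * b) := by ring
  rw [this]
  exact (IsSumSq.mul_self c).mul hab'

theorem isSumSq_binary {f f' : MvPolynomial (Fin 3) ℝ} (hf : f.IsHomogeneous 3)
    (hf' : f'.IsHomogeneous 3) (a b c : ℝ)
    (hp : Psd (C a * f ^ 2 + C b * (f * f') + C c * f' ^ 2)) :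
    IsSumSq (C a * f ^ 2 + C b * (f * f') + C c * f' ^ 2) := by
  by_cases ha : a = 0
  · have e : C a * f ^ 2 + C b * (f * f') + C c * f' ^ 2 = (C b * f + C c * f') * f' := by
      rw [ha, C_0]; ring
    rw [e] at hp ⊢
    exact isSumSq_mul_cubics ((hf.C_mul b).add (hf'.C_mul c)) hf' hp
  by_cases hD : 0 ≤ b ^ 2 - 4 * a * c
  · set s := √(b ^ 2 - 4 * a * c) with hs
    have hs2 : s ^ 2 = b ^ 2 - 4 * a * c := Real.sq_sqrt hD
    have e : C a * f ^ 2 + C b * (f * f') + C c * f' ^ 2 =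
        (C a * f + C ((b + s) / 2) * f') * (C 1 * f + C ((b - s) / (2 * a)) * f') := by
      apply MvPolynomial.funext
      intro u
      simp only [map_add, map_mul, map_pow, eval_C]
      field_simp
      linear_combination (eval u f') ^ 2 * hs2
    rw [e] at hp ⊢
    exact isSumSq_mul_cubics ((hf.C_mul _).add (hf'.C_mul _)) ((hf.C_mul _).add (hf'.C_mul _)) hp
  · push Not at hD
    have e : C a * f ^ 2 + C b * (f * f') + C c * f' ^ 2 =
        C a * ((f + C (b / (2 * a)) * f') * (f + C (b / (2 * a)) * f') +
          C ((4 * a * c - b ^ 2) / (4 * a ^ 2)) * (f' * f')) := by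
      apply MvPolynomial.funext
      intro u
      simp only [map_add, map_mul, map_pow, eval_C]
      field_simp
      ring
    have hk : 0 ≤ (4 * a * c - b ^ 2) / (4 * a ^ 2) := div_nonneg (by linarith) (by positivity)
    have hin : IsSumSq ((f + C (b / (2 * a)) * f') * (f + C (b / (2 * a)) * f') +
          C ((4 * a * c - b ^ 2) / (4 * a ^ 2)) * (f' * f')) :=
      (IsSumSq.mul_self _).add ((isSumSq_C hk).mul (IsSumSq.mul_self _))
    rcases lt_or_gt_of_ne ha with ha | ha
    · have : C a * f ^ 2 + C b * (f * f') + C c * f' ^ 2 = 0 := by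
        apply MvPolynomial.funext
        intro u
        have h1 := hp u
        rw [e] at h1 ⊢
        simp only [map_add, map_mul, eval_C, map_zero] at h1 ⊢
        have h3 := mul_nonneg hk (mul_self_nonneg (eval u f'))
        have h4 := mul_self_nonneg (eval u f + b / (2 * a) * eval u f')
        apply le_antisymm _ h1
        exact mul_nonpos_of_nonpos_of_nonneg ha.le (add_nonneg h4 h3)
      rw [this]; exact IsSumSq.zero
    · rw [e]
      exact (isSumSq_C ha.le).mul hin

theorem pderiv_line (u : Fin 3 → ℝ) (i : Fin 3) (p : MvPolynomial (Fin 3) ℝ) :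
    HasDerivAt (fun t : ℝ => eval (u + t • Pi.single i (1 : ℝ)) p) (eval u (pderiv i p)) 0 := by
  induction p using MvPolynomial.induction_on with
  | C a => simpa using hasDerivAt_const (0 : ℝ) a
  | add p q hp hq => simpa using! hp.add hq
  | mul_X p j hp =>
    have h1 : HasDerivAt (fun t : ℝ => u j + t * (Pi.single i (1 : ℝ) : Fin 3 → ℝ) j)
        ((Pi.single i (1 : ℝ) : Fin 3 → ℝ) j) 0 := by
      simpa using ((hasDerivAt_id (0 : ℝ)).mul_const
        ((Pi.single i (1 : ℝ) : Fin 3 → ℝ) j)).const_add (u j)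
    have h2 := hp.mul h1
    have e : eval u (pderiv i (p * X j)) = eval u (pderiv i p) * u j +
        eval u p * (Pi.single i (1 : ℝ) : Fin 3 → ℝ) j := by
      simp only [Derivation.leibniz, pderiv_X, smul_eq_mul, map_add, map_mul, eval_X]
      by_cases hij : i = j
      · subst hij; simp; ring
      · simp [Pi.single_apply, hij, Ne.symm hij]; ring
    rw [e]
    simpa using! h2

theorem psd_sing {p : MvPolynomial (Fin 3) ℝ} (hp : Psd p) {P : P2} (h : VanishAt p P) :
    SingAt p P := by
  refine ⟨h, fun i => ?_⟩
  have hd := pderiv_line P.rep i p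
  refine IsLocalMin.hasDerivAt_eq_zero ?_ hd
  refine Filter.Eventually.of_forall fun t => ?_
  simp only [zero_smul, add_zero]
  rw [show eval P.rep p = 0 from h]
  exact hp _

theorem statement18 (S : Set P2) (hS9 : S.encard = 9)
    (hex : ∃ g : MvPolynomial (Fin 3) ℝ, g.IsHomogeneous 6 ∧ Psd g ∧
      (∀ P ∈ S, VanishAt g P) ∧ ¬ Sos g)
    (P : P2) (hP : P ∈ S) (T : Set P2) (hT : T = S \ {P})
    (f f' g : MvPolynomial (Fin 3) ℝ)
    (hspan3 : Submodule.span ℝ {f, f'} = Isub 3 T)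
    (hspan6 : Submodule.span ℝ {f ^ 2, f * f', f' ^ 2, g} = Isub2 6 T) :
    VanishAt (jacR f f' g) P := by
  obtain ⟨p, hp6, hpsd, hpS, hns⟩ := hex
  have hf : f.IsHomogeneous 3 := by
    have : f ∈ Isub 3 T := hspan3 ▸ Submodule.subset_span (by simp)
    exact this.1
  have hf' : f'.IsHomogeneous 3 := by
    have : f' ∈ Isub 3 T := hspan3 ▸ Submodule.subset_span (by simp)
    exact this.1
  have hpm : p ∈ Isub2 6 T := by
    refine ⟨hp6, fun Q hQ => psd_sing hpsd (hpS Q ?_)⟩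
    rw [hT] at hQ
    exact hQ.1
  rw [← hspan6] at hpm
  simp only [Submodule.mem_span_insert, Submodule.mem_span_singleton] at hpm
  obtain ⟨a, _, ⟨b, _, ⟨c, _, ⟨d, rfl⟩, rfl⟩, rfl⟩, e⟩ := hpm
  simp only [smul_eq_C_mul] at e
  have hd : d ≠ 0 := by
    rintro rfl
    apply hns
    apply sos_of_isSumSq
    have e' : p = C a * f ^ 2 + C b * (f * f') + C c * f' ^ 2 := by
      rw [e, C_0]; ring
    rw [e'] at hpsd ⊢
    exact isSumSq_binary hf hf' a b c hpsd
  obtain ⟨-, hsing⟩ := psd_sing hpsd (hpS P hP)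
  set u := P.rep with hu
  have key : ∀ i, eval u (pderiv i g) =
      (-(2 * a * eval u f + b * eval u f') / d) * eval u (pderiv i f) +
      (-(b * eval u f + 2 * c * eval u f') / d) * eval u (pderiv i f') := by
    intro i
    have h1 := hsing i
    rw [e] at h1
    simp [Derivation.leibniz, Derivation.leibniz_pow] at h1
    field_simp
    linear_combination h1
  unfold VanishAt jacR
  rw [Matrix.det_fin_three]
  simp [← hu, key]
  ring

end
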